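/- arXiv:1206.1703 — 2 statements merged into one kernel-verified Lean document; each statement's English description precedes it below -/
import Mathlib

section
/- Let H₁ and H₂ be complex Hilbert spaces, and let L be the bounded operator on H = H₁ ⊕ H₂ with block matrix [[P, Q], [R, S]], where P : H₁ → H₁, Q : H₂ → H₁, R : H₁ → H₂, S : H₂ → H₂ are bounded, P and S are invertible, and for some constants c > 0 and 0 < ε ≤ 1/(2c) one has ‖Q‖ ≤ c, ‖R‖ ≤ c, ‖S^{-1}‖ ≤ 1/(2c) and ‖P^{-1}‖ < ε. Then L is invertible and ‖L^{-1} - [[0, 0], [0, S^{-1}]]‖ < 2ε. -/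
/-- If `Pinv` is the inverse of `P` and `‖Pinv ∘ M‖ ≤ 1/4`, then `P - M` has a two-sided
inverse, of norm at most `4/3 * ‖Pinv‖`. -/
lemma exists_inverse_sub_of_norm_comp_le {E : Type*} [NormedAddCommGroup E] [NormedSpace ℂ E]
    [CompleteSpace E] (P Pinv M : E →L[ℂ] E) (hP1 : P.comp Pinv = 1) (hP2 : Pinv.comp P = 1)
    (hM : ‖Pinv.comp M‖ ≤ 1 / 4) :
    ∃ B : E →L[ℂ] E, (∀ v, P (B v) - M (B v) = v) ∧ (∀ v, B (P v - M v) = v) ∧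
      ∀ v, ‖B v‖ ≤ 4 / 3 * ‖Pinv‖ * ‖v‖ := by
  have hP1' : ∀ v, P (Pinv v) = v := fun v => DFunLike.congr_fun hP1 v
  have hP2' : ∀ v, Pinv (P v) = v := fun v => DFunLike.congr_fun hP2 v
  let U := Units.oneSub (Pinv.comp M) (hM.trans_lt (by norm_num))
  have hU : (U : E →L[ℂ] E) = 1 - Pinv.comp M := rfl
  have hU1 : ∀ v, (↑U⁻¹ : E →L[ℂ] E) v - Pinv (M ((↑U⁻¹ : E →L[ℂ] E) v)) = v := fun v => by
    simpa [hU] using DFunLike.congr_fun U.mul_inv v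
  have hU2 : ∀ v, (↑U⁻¹ : E →L[ℂ] E) (v - Pinv (M v)) = v := fun v => by
    simpa [hU] using DFunLike.congr_fun U.inv_mul v
  refine ⟨(↑U⁻¹ : E →L[ℂ] E).comp Pinv, fun v => ?_, fun v => ?_, fun v => ?_⟩
  · simpa only [map_sub, hP1', ContinuousLinearMap.comp_apply] using congrArg P (hU1 (Pinv v))
  · rw [ContinuousLinearMap.comp_apply, map_sub Pinv, hP2', hU2]
  · have h := hU1 (Pinv v)
    rw [ContinuousLinearMap.comp_apply]
    generalize (↑U⁻¹ : E →L[ℂ] E) (Pinv v) = w at h ⊢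
    have hw : ‖w‖ ≤ ‖Pinv v‖ + ‖Pinv.comp M w‖ := by
      rw [← h]
      simpa using norm_add_le (w - Pinv (M w)) (Pinv (M w))
    have hK := (Pinv.comp M).le_of_opNorm_le hM w
    have hv := Pinv.le_opNorm v
    linarith

/-- Let `L` be the block operator `[[P, Q], [R, S]]` on the orthogonal
direct sum `H = H₁ ⊕ H₂` (realised as `WithLp 2 (H₁ × H₂)`), where `P` and `S` are invertible,
`‖Q‖ ≤ c`, `‖R‖ ≤ c`, `‖S⁻¹‖ ≤ 1/(2c)` and `‖P⁻¹‖ < ε ≤ 1/(2c)`.  Then `L` is invertible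
and `‖L⁻¹ - [[0,0],[0,S⁻¹]]‖ < 2ε`. -/
theorem block_operator_inverse_estimate
    {H₁ H₂ : Type*} [NormedAddCommGroup H₁] [InnerProductSpace ℂ H₁] [CompleteSpace H₁]
    [NormedAddCommGroup H₂] [InnerProductSpace ℂ H₂] [CompleteSpace H₂]
    (P : H₁ →L[ℂ] H₁) (Q : H₂ →L[ℂ] H₁) (R : H₁ →L[ℂ] H₂) (S : H₂ →L[ℂ] H₂)
    (Pinv : H₁ →L[ℂ] H₁) (hP1 : P.comp Pinv = 1) (hP2 : Pinv.comp P = 1)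
    (Sinv : H₂ →L[ℂ] H₂) (hS1 : S.comp Sinv = 1) (hS2 : Sinv.comp S = 1)
    (c ε : ℝ) (hc : 0 < c) (hε : 0 < ε) (hεc : ε ≤ 1 / (2 * c))
    (hQ : ‖Q‖ ≤ c) (hR : ‖R‖ ≤ c) (hSinv : ‖Sinv‖ ≤ 1 / (2 * c)) (hPinv : ‖Pinv‖ < ε)
    (L T : WithLp 2 (H₁ × H₂) →L[ℂ] WithLp 2 (H₁ × H₂))
    (hL : ∀ (x : H₁) (y : H₂),
      L ((WithLp.equiv 2 (H₁ × H₂)).symm (x, y)) =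
        (WithLp.equiv 2 (H₁ × H₂)).symm (P x + Q y, R x + S y))
    (hT : ∀ (x : H₁) (y : H₂),
      T ((WithLp.equiv 2 (H₁ × H₂)).symm (x, y)) =
        (WithLp.equiv 2 (H₁ × H₂)).symm (0, Sinv y)) :
    ∃ Linv : WithLp 2 (H₁ × H₂) →L[ℂ] WithLp 2 (H₁ × H₂),
      L.comp Linv = 1 ∧ Linv.comp L = 1 ∧ ‖Linv - T‖ < 2 * ε := by
  have hc2 : ‖Sinv‖ * c ≤ 1 / 2 := by
    calc ‖Sinv‖ * c ≤ 1 / (2 * c) * c := by gcongr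
      _ = 1 / 2 := by field_simp
  have hPc : ‖Pinv‖ * c ≤ 1 / 2 := by
    calc ‖Pinv‖ * c ≤ 1 / (2 * c) * c := by gcongr; exact hPinv.le.trans hεc
      _ = 1 / 2 := by field_simp
  have hQS : ‖Q.comp Sinv‖ ≤ 1 / 2 := by
    calc ‖Q.comp Sinv‖ ≤ ‖Q‖ * ‖Sinv‖ := Q.opNorm_comp_le Sinv
      _ ≤ c * ‖Sinv‖ := by gcongr
      _ ≤ 1 / 2 := by linarith
  have hSR : ‖Sinv.comp R‖ ≤ 1 / 2 := by
    calc ‖Sinv.comp R‖ ≤ ‖Sinv‖ * ‖R‖ := Sinv.opNorm_comp_le R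
      _ ≤ ‖Sinv‖ * c := by gcongr
      _ ≤ 1 / 2 := hc2
  have hK : ‖Pinv.comp (Q.comp (Sinv.comp R))‖ ≤ 1 / 4 := by
    calc ‖Pinv.comp (Q.comp (Sinv.comp R))‖ ≤ ‖Pinv‖ * (‖Q‖ * ‖Sinv.comp R‖) :=
          (Pinv.opNorm_comp_le _).trans (by gcongr; exact Q.opNorm_comp_le _)
      _ ≤ ‖Pinv‖ * (c * (1 / 2)) := by gcongr
      _ ≤ 1 / 4 := by linarith
  obtain ⟨B, hB1, hB2, hB⟩ :=
    exists_inverse_sub_of_norm_comp_le P Pinv (Q.comp (Sinv.comp R)) hP1 hP2 hK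
  simp only [ContinuousLinearMap.comp_apply] at hB1 hB2
  have hS1' : ∀ v, S (Sinv v) = v := fun v => DFunLike.congr_fun hS1 v
  have hS2' : ∀ v, Sinv (S v) = v := fun v => DFunLike.congr_fun hS2 v
  simp only [WithLp.equiv_symm_apply] at hL hT
  let e := WithLp.prodContinuousLinearEquiv 2 ℂ H₁ H₂
  -- The difference `L⁻¹ - T` factors as a column times `B` times a row.
  let D : WithLp 2 (H₁ × H₂) →L[ℂ] WithLp 2 (H₁ × H₂) :=
    (e.symm : H₁ × H₂ →L[ℂ] WithLp 2 (H₁ × H₂)).comp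
      ((((ContinuousLinearMap.id ℂ H₁).prod (-(Sinv.comp R))).comp B).comp
        (((ContinuousLinearMap.id ℂ H₁).coprod (-(Q.comp Sinv))).comp
          (e : WithLp 2 (H₁ × H₂) →L[ℂ] H₁ × H₂)))
  have hD : ∀ x y, D (WithLp.toLp 2 (x, y)) =
      WithLp.toLp 2 (B (x - Q (Sinv y)), -Sinv (R (B (x - Q (Sinv y))))) := fun x y => by
    simp [D, e, sub_eq_add_neg]
  refine ⟨T + D, ?_, ?_, ?_⟩
  · ext1 z
    obtain ⟨x, y⟩ := z
    have h := hB1 (x - Q (Sinv y))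
    simp only [ContinuousLinearMap.comp_apply, add_apply, hT, hD,
      ← WithLp.toLp_add, Prod.mk_add_mk, hL, one_apply_eq_self]
    congr 2
    · rw [zero_add, map_add, map_neg, ← sub_eq_add_neg, add_sub, add_sub_right_comm, h,
        sub_add_cancel]
    · rw [zero_add, map_add S, map_neg, hS1', hS1']; abel
  · ext1 z
    obtain ⟨x, y⟩ := z
    have h : B (P x + Q y - Q (Sinv (R x + S y))) = x := by
      rw [map_add Sinv, hS2', map_add Q, add_sub_add_right_eq_sub, hB2]
    simp only [ContinuousLinearMap.comp_apply, add_apply, hT, hD, hL, h,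
      ← WithLp.toLp_add, Prod.mk_add_mk, one_apply_eq_self]
    simp [hS2']
  · rw [add_sub_cancel_left]
    have hDn : ‖D‖ ≤ 5 / 3 * ‖Pinv‖ := by
      refine D.opNorm_le_bound (by positivity) fun z => ?_
      obtain ⟨x, y⟩ := z
      rw [hD]
      have hv : ‖x - Q (Sinv y)‖ ≤ ‖x‖ + 1 / 2 * ‖y‖ :=
        (norm_sub_le _ _).trans (by gcongr; exact (Q.comp Sinv).le_of_opNorm_le hQS y)
      have hw := hB (x - Q (Sinv y))
      generalize x - Q (Sinv y) = v at hv hw ⊢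
      have hu : ‖Sinv (R (B v))‖ ≤ 1 / 2 * ‖B v‖ := (Sinv.comp R).le_of_opNorm_le hSR (B v)
      refine le_of_sq_le_sq ?_ (by positivity)
      rw [mul_pow, WithLp.prod_norm_sq_eq_of_L2, WithLp.prod_norm_sq_eq_of_L2]
      simp only [WithLp.toLp_fst, WithLp.toLp_snd, norm_neg]
      calc ‖B v‖ ^ 2 + ‖Sinv (R (B v))‖ ^ 2
          ≤ ‖B v‖ ^ 2 + (1 / 2 * ‖B v‖) ^ 2 := by gcongr
        _ = 5 / 4 * ‖B v‖ ^ 2 := by ring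
        _ ≤ 5 / 4 * (4 / 3 * ‖Pinv‖ * (‖x‖ + 1 / 2 * ‖y‖)) ^ 2 := by
          gcongr
          exact hw.trans (by gcongr)
        _ = 20 / 9 * ‖Pinv‖ ^ 2 * (‖x‖ + 1 / 2 * ‖y‖) ^ 2 := by ring
        _ ≤ 20 / 9 * ‖Pinv‖ ^ 2 * (5 / 4 * (‖x‖ ^ 2 + ‖y‖ ^ 2)) := by
          gcongr
          nlinarith [sq_nonneg (1 / 2 * ‖x‖ - ‖y‖)]
        _ = (5 / 3 * ‖Pinv‖) ^ 2 * (‖x‖ ^ 2 + ‖y‖ ^ 2) := by ring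
    linarith
end

section
/- Let A be a bounded self-adjoint operator on a complex Hilbert space H, let K be a complex Hilbert space, and let C : K → H and D : H → K be bounded operators. If λ ∉ Spec(A) and γ ∈ ℂ with γ ≠ 0, then λ is an eigenvalue of A + γCD if and only if -1/γ is an eigenvalue of m(λ) = D(A - λI)^{-1}C, a bounded operator on K. -/
/-- **Birman–Schwinger principle.** Let `A` be bounded self-adjoint on `H`,
`C : K → H` and `D : H → K` bounded, `λ ∉ Spec(A)` and `γ ≠ 0`.  Then `λ` is an eigenvalue of
`A + γCD` if and only if `-1/γ` is an eigenvalue of `m(λ) = D (A - λI)⁻¹ C` on `K`. -/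
theorem birman_schwinger {H K : Type*}
    [NormedAddCommGroup H] [InnerProductSpace ℂ H] [CompleteSpace H]
    [NormedAddCommGroup K] [InnerProductSpace ℂ K] [CompleteSpace K]
    (A : H →L[ℂ] H) (hA : IsSelfAdjoint A) (C : K →L[ℂ] H) (D : H →L[ℂ] K)
    (l γ : ℂ) (hl : l ∉ spectrum ℂ A) (hγ : γ ≠ 0) :
    (∃ f : H, f ≠ 0 ∧ (A + γ • (C.comp D)) f = l • f) ↔
    (∃ g : K, g ≠ 0 ∧
      (D.comp ((Ring.inverse (A - l • (1 : H →L[ℂ] H))).comp C)) g = (-1 / γ) • g) := by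
  have hu : IsUnit (A - l • (1 : H →L[ℂ] H)) := by
    have h := (spectrum.notMem_iff.mp hl).neg
    rwa [neg_sub, Algebra.algebraMap_eq_smul_one] at h
  set R := Ring.inverse (A - l • (1 : H →L[ℂ] H))
  have left_inv (x : H) : R (A x - l • x) = x := by
    simpa using DFunLike.congr_fun (Ring.inverse_mul_cancel _ hu) x
  have right_inv (x : H) : A (R x) - l • R x = x := by
    simpa using DFunLike.congr_fun (Ring.mul_inverse_cancel _ hu) x
  simp only [add_apply, smul_apply, ContinuousLinearMap.comp_apply]
  constructor
  · rintro ⟨f, hf, hfl⟩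
    have hRf : f = -γ • R (C (D f)) := by
      have hAf : A f - l • f = -γ • C (D f) := by rw [← hfl]; simp
      rw [← map_smul, ← hAf, left_inv]
    refine ⟨D f, fun h => hf (by rw [hRf, h]; simp), ?_⟩
    have hDf : D f = -γ • D (R (C (D f))) := by rw [← map_smul, ← hRf]
    rw [eq_comm]
    nth_rewrite 1 [hDf]
    rw [smul_smul, show -1 / γ * -γ = 1 by field_simp, one_smul]
  · rintro ⟨g, hg, hgl⟩
    refine ⟨R (C g), fun h => hg ?_, ?_⟩
    · rw [h, map_zero] at hgl
      simpa [hγ] using hgl.symm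
    · rw [hgl, map_smul, smul_smul, show γ * (-1 / γ) = -1 by field_simp, neg_one_smul,
        ← sub_eq_add_neg, sub_eq_iff_eq_add', ← sub_eq_iff_eq_add]
      exact right_inv _
end
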